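/- arXiv:1802.07771 — 2 statements merged into one kernel-verified Lean document; each statement's English description precedes it below -/
import Mathlib

section
/- Let R be a rack and a, b ∈ R. Then c := f_a⁻¹(b) satisfies ⟪a◃c⟫ = ⟪b⟫, and for any x ∈ R with ⟪a◃x⟫ = ⟪b⟫ one has ⟪x⟫ = ⟪c⟫. (This is the bijectivity condition for the quandle operation ⟪a⟫ * ⟪b⟫ := ⟪a◃b⟫ on the corresponding quandle of R.) -/
open Quandles

/-- A subrack of a rack `R`: a subset closed under the action and its inverse. -/
def IsSubrack {R : Type*} [Rack R] (Q : Set R) : Prop :=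
  ∀ a ∈ Q, ∀ b ∈ Q, a ◃ b ∈ Q ∧ (Rack.act' a).symm b ∈ Q

/-- The subrack generated by a subset `S` of a rack: the intersection of all subracks
containing `S`. -/
def subrackGen {R : Type*} [Rack R] (S : Set R) : Set R :=
  ⋂₀ {Q : Set R | IsSubrack Q ∧ S ⊆ Q}

theorem act_invAct_distrib {R : Type*} [Rack R] (a y z : R) :
    a ◃ (y ◃⁻¹ z) = (a ◃ y) ◃⁻¹ (a ◃ z) := by
  rw [← Rack.left_cancel (a ◃ y), ← Shelf.self_distrib, Rack.act_invAct_eq, Rack.act_invAct_eq]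

theorem invAct_act_distrib {R : Type*} [Rack R] (a y z : R) :
    a ◃⁻¹ (y ◃ z) = (a ◃⁻¹ y) ◃ (a ◃⁻¹ z) := by
  rw [← Rack.left_cancel a, Shelf.self_distrib]
  simp only [Rack.act_invAct_eq]

theorem IsSubrack.preimage_act {R : Type*} [Rack R] {Q : Set R} (hQ : IsSubrack Q) (a : R) :
    IsSubrack {y | a ◃ y ∈ Q} := by
  intro y hy z hz
  have h := hQ _ hy _ hz
  simp only [Rack.act'_symm_apply, Set.mem_ofPred_eq] at h ⊢
  rwa [Shelf.self_distrib, act_invAct_distrib]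

theorem IsSubrack.preimage_invAct {R : Type*} [Rack R] {Q : Set R} (hQ : IsSubrack Q) (a : R) :
    IsSubrack {y | a ◃⁻¹ y ∈ Q} := by
  intro y hy z hz
  have h := hQ _ hy _ hz
  simp only [Rack.act'_symm_apply, Set.mem_ofPred_eq] at h ⊢
  rwa [invAct_act_distrib, Rack.self_distrib_inv]

/-- Acting by `a` carries the subrack generated by `x` onto the one generated by `a ◃ x`. -/
theorem act_mem_subrackGen_singleton_iff {R : Type*} [Rack R] (a x y : R) :
    a ◃ y ∈ subrackGen {a ◃ x} ↔ y ∈ subrackGen {x} := by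
  simp only [subrackGen, Set.mem_sInter, Set.mem_ofPred_eq, Set.singleton_subset_iff]
  constructor
  · rintro h Q ⟨hQ, hx⟩
    simpa using h _ ⟨hQ.preimage_invAct a, by simpa using hx⟩
  · rintro h Q ⟨hQ, hx⟩
    exact h _ ⟨hQ.preimage_act a, hx⟩

/-- with `c := f_a⁻¹ b` one has `⟪a ◃ c⟫ = ⟪b⟫`, and any `x` with
`⟪a ◃ x⟫ = ⟪b⟫` satisfies `⟪x⟫ = ⟪c⟫` (bijectivity for the corresponding quandle). -/
theorem stmt_6 {R : Type*} [Rack R] (a b : R) :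
    subrackGen {a ◃ (Rack.act' a).symm b} = subrackGen {b} ∧
    ∀ x : R, subrackGen {a ◃ x} = subrackGen {b} →
      subrackGen {x} = subrackGen {(Rack.act' a).symm b} := by
  have hc : a ◃ (Rack.act' a).symm b = b := Rack.act_invAct_eq a b
  refine ⟨by rw [hc], fun x hx => ?_⟩
  ext y
  rw [← act_mem_subrackGen_singleton_iff a x, hx,
    ← act_mem_subrackGen_singleton_iff a ((Rack.act' a).symm b), hc]
end

section
/- Let R be a rack. A subrack Q of R is an atom of the lattice of subracks of R — that is, Q ≠ ∅ and the only subrack properly contained in Q is ∅ — if and only if Q = ⟪a⟫ for some a ∈ R. -/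
open Quandles

theorem isSubrack_subrackGen {R : Type*} [Rack R] (S : Set R) : IsSubrack (subrackGen S) :=
  fun a ha b hb =>
    ⟨fun P hP => (hP.1 a (ha P hP) b (hb P hP)).1, fun P hP => (hP.1 a (ha P hP) b (hb P hP)).2⟩

theorem subset_subrackGen {R : Type*} [Rack R] (S : Set R) : S ⊆ subrackGen S :=
  fun _ hx _ hP => hP.2 hx

theorem subrackGen_subset {R : Type*} [Rack R] {S Q : Set R} (hQ : IsSubrack Q) (h : S ⊆ Q) :
    subrackGen S ⊆ Q :=
  fun _ hx => hx Q ⟨hQ, h⟩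

theorem mem_subrackGen_self {R : Type*} [Rack R] (a : R) : a ∈ subrackGen {a} :=
  subset_subrackGen {a} rfl

theorem mem_subrackGen_singleton_trans {R : Type*} [Rack R] {a b c : R}
    (hab : a ∈ subrackGen {b}) (hbc : b ∈ subrackGen {c}) : a ∈ subrackGen {c} :=
  subrackGen_subset (isSubrack_subrackGen {c}) (Set.singleton_subset_iff.2 hbc) hab

/-- The elements acting like `a` and generating a subrack that contains `a` form a subrack. -/
theorem isSubrack_setOf_act'_eq_and_mem_subrackGen {R : Type*} [Rack R] (a : R) :
    IsSubrack {b : R | Rack.act' b = Rack.act' a ∧ a ∈ subrackGen {b}} := by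
  rintro b ⟨hb, -⟩ c ⟨hc, hac⟩
  constructor
  · have hact : Rack.act' (b ◃ c) = Rack.act' a := by
      rw [Rack.ad_conj, hb, hc, mul_inv_cancel_right]
    refine ⟨hact, mem_subrackGen_singleton_trans hac ?_⟩
    have hmem := mem_subrackGen_self (b ◃ c)
    have h := (isSubrack_subrackGen {b ◃ c} _ hmem _ hmem).2
    rwa [hact, ← hb, Rack.act'_symm_apply, Rack.invAct_act_eq] at h
  · obtain ⟨d, rfl⟩ := (Rack.act' b).surjective c
    rw [Equiv.symm_apply_apply]
    rw [Rack.act'_apply] at hc hac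
    have hact : Rack.act' d = Rack.act' a := by
      rw [Rack.ad_conj, hb, mul_inv_eq_iff_eq_mul] at hc
      exact mul_left_cancel hc
    refine ⟨hact, mem_subrackGen_singleton_trans hac ?_⟩
    have hmem := mem_subrackGen_self d
    have h := (isSubrack_subrackGen {d} _ hmem _ hmem).1
    rwa [← Rack.act'_apply, hact, ← hb, Rack.act'_apply] at h

theorem mem_subrackGen_singleton_symm {R : Type*} [Rack R] {a b : R}
    (hb : b ∈ subrackGen {a}) : a ∈ subrackGen {b} :=
  (subrackGen_subset (isSubrack_setOf_act'_eq_and_mem_subrackGen a)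
    (Set.singleton_subset_iff.2 ⟨rfl, mem_subrackGen_self a⟩) hb).2

/-- a subrack `Q` is an atom of the lattice of subracks (i.e. `Q ≠ ∅` and
the only subrack properly contained in `Q` is `∅`) iff `Q = ⟪a⟫` for some `a ∈ R`. -/
theorem stmt_7 {R : Type*} [Rack R] (Q : Set R) (hQ : IsSubrack Q) :
    (Q ≠ ∅ ∧ ∀ Q' : Set R, IsSubrack Q' → Q' ⊂ Q → Q' = ∅) ↔
      ∃ a : R, Q = subrackGen {a} := by
  constructor
  · rintro ⟨hne, hmin⟩
    obtain ⟨a, ha⟩ := Set.nonempty_iff_ne_empty.2 hne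
    have hsub : subrackGen {a} ⊆ Q := subrackGen_subset hQ (Set.singleton_subset_iff.2 ha)
    refine ⟨a, by_contra fun hneq => ?_⟩
    have hempty := hmin _ (isSubrack_subrackGen {a}) (hsub.ssubset_of_ne (Ne.symm hneq))
    exact Set.notMem_empty a (hempty ▸ mem_subrackGen_self a)
  · rintro ⟨a, rfl⟩
    refine ⟨Set.nonempty_iff_ne_empty.1 ⟨a, mem_subrackGen_self a⟩, fun P hP hlt => ?_⟩
    refine Set.eq_empty_of_forall_notMem fun b hb => hlt.2 ?_
    refine subrackGen_subset hP (Set.singleton_subset_iff.2 ?_)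
    exact subrackGen_subset hP (Set.singleton_subset_iff.2 hb)
      (mem_subrackGen_singleton_symm (hlt.1 hb))
end
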